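/- (Proposition 4.2) For every M ≥ 1 there exist H ≥ 1 and ε > 0, depending only on M, such that the following holds. Let f : 𝕎 → ℍ be M-bilipschitz, let θ ∈ [−π/2, π/2), and let Q ∈ 𝒟 be a rectangle such that β_f(𝕍; HQ) < ε/H for some vertical plane 𝕍 with ∠(𝕍, 𝕎_θ) = 0. Then ℋ³(Π_θ(f(HQ))) ≥ ℓ(Q)³. -/

import Mathlib

open scoped ENNReal

namespace HeisRug

/-- The first Heisenberg group, as a set: ℝ³. -/
abbrev Hei : Type := ℝ × ℝ × ℝ

/-- Heisenberg group multiplication. -/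
noncomputable def Hmul (p q : Hei) : Hei :=
  (p.1 + q.1, p.2.1 + q.2.1, p.2.2 + q.2.2 + (p.1 * q.2.1 - q.1 * p.2.1) / 2)

/-- Heisenberg group inverse. -/
def Hinv (p : Hei) : Hei := (-p.1, -p.2.1, -p.2.2)

/-- Homogeneous norm on the Heisenberg group. -/
noncomputable def Hnorm (p : Hei) : ℝ :=
  max (Real.sqrt (p.1 ^ 2 + p.2.1 ^ 2)) (Real.sqrt |p.2.2|)

/-- Left-invariant metric `d(p,q) = ‖q⁻¹·p‖` on the Heisenberg group. -/
noncomputable def dH (p q : Hei) : ℝ := Hnorm (Hmul (Hinv q) p)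

/-- Parabolic metric on the parabolic plane 𝕎 = ℝ². -/
noncomputable def dPar (w w' : ℝ × ℝ) : ℝ :=
  max |w.1 - w'.1| (Real.sqrt |w.2 - w'.2|)

/-- Distance from a point to a set in (ℍ, d). -/
noncomputable def distH (p : Hei) (E : Set Hei) : ℝ := sInf ((dH p) '' E)

/-- Closed δ-neighbourhood of a set in ℍ. -/
def NH (E : Set Hei) (δ : ℝ) : Set Hei := {p | distH p E ≤ δ}

/-- Closed ball in (ℍ, d). -/
def BH (p : Hei) (r : ℝ) : Set Hei := {q | dH q p ≤ r}

/-- Closed parabolic ball in 𝕎. -/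
def BPar (w : ℝ × ℝ) (r : ℝ) : Set (ℝ × ℝ) := {v | dPar v w ≤ r}

/-- Diameter (in ℝ≥0∞) with respect to the Heisenberg metric. -/
noncomputable def ediamH (E : Set Hei) : ℝ≥0∞ :=
  ⨆ p ∈ E, ⨆ q ∈ E, ENNReal.ofReal (dH p q)

/-- The 3-dimensional Hausdorff measure on (ℍ, d), as a set function. -/
noncomputable def H3 (E : Set Hei) : ℝ≥0∞ :=
  ⨆ (δ : ℝ≥0∞) (_ : 0 < δ),
    ⨅ (U : ℕ → Set Hei) (_ : E ⊆ ⋃ n, U n) (_ : ∀ n, ediamH (U n) ≤ δ),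
      ∑' n, ediamH (U n) ^ 3

/-- Isometric embedding of the parabolic plane onto the subgroup 𝕎 ⊂ ℍ. -/
def embedW (w : ℝ × ℝ) : Hei := (0, w.1, w.2)

/-- The vertical subgroup 𝕎 = {(0,y,t)} of ℍ. -/
def Wsub : Set Hei := {p | p.1 = 0}

/-- Rotation by angle θ about the t-axis. -/
noncomputable def Rrot (θ : ℝ) (p : Hei) : Hei :=
  (p.1 * Real.cos θ - p.2.1 * Real.sin θ, p.1 * Real.sin θ + p.2.1 * Real.cos θ, p.2.2)

/-- Vertical projection Π : ℍ → 𝕎. -/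
noncomputable def Piproj (p : Hei) : Hei := (0, p.2.1, p.2.2 + p.1 * p.2.1 / 2)

/-- Horizontal projection Π_𝕃 : ℍ → 𝕃. -/
def PiL (p : Hei) : Hei := (p.1, 0, 0)

/-- Vertical projection Π_θ = R_θ ∘ Π ∘ R_θ⁻¹ onto 𝕎_θ. -/
noncomputable def PiTheta (θ : ℝ) (p : Hei) : Hei := Rrot θ (Piproj (Rrot (-θ) p))

/-- `f : 𝕎 → ℍ` is M-bilipschitz. -/
def IsBilipschitz (M : ℝ) (f : ℝ × ℝ → Hei) : Prop :=
  ∀ w w' : ℝ × ℝ,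
    M⁻¹ * dPar w w' ≤ dH (f w) (f w') ∧ dH (f w) (f w') ≤ M * dPar w w'

/-- A Rickman rug: the image of the parabolic plane under a bilipschitz map. -/
def IsRickmanRug (E : Set Hei) : Prop :=
  ∃ M : ℝ, 1 ≤ M ∧ ∃ f : ℝ × ℝ → Hei, IsBilipschitz M f ∧ E = Set.range f

/-- A horizontal line in ℍ. -/
def IsHorizontalLine (L : Set Hei) : Prop :=
  ∃ p : Hei, ∃ v : ℝ × ℝ, v ≠ 0 ∧
    L = {q | ∃ s : ℝ, q = Hmul p (s * v.1, s * v.2, 0)}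

/-- The vertical plane spanned by a horizontal line. -/
def VSpan (L : Set Hei) : Set Hei := {q | ∃ p ∈ L, ∃ t : ℝ, q = Hmul p (0, 0, t)}

/-- Vertical planes in ℍ. -/
def IsVerticalPlane (V : Set Hei) : Prop :=
  ∃ L : Set Hei, IsHorizontalLine L ∧ V = VSpan L

/-- The horizontal line {(a·y + b, y, b·y/2 + c) : y ∈ ℝ} (of slope |a|). -/
def hline (a b c : ℝ) : Set Hei :=
  {p | ∃ y : ℝ, p = (a * y + b, y, b * y / 2 + c)}

/-- A horizontal line of (finite) slope at most Σ. -/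
def HLineSlopeLe (S : ℝ) (L : Set Hei) : Prop :=
  ∃ a b c : ℝ, |a| ≤ S ∧ L = hline a b c

/-- A vertical plane of (finite) slope at most Σ (relative to 𝕎). -/
def VPlaneSlopeLe (S : ℝ) (V : Set Hei) : Prop :=
  ∃ a b : ℝ, |a| ≤ S ∧ V = {p : Hei | p.1 = a * p.2.1 + b}

/-- A vertical plane whose slope relative to 𝕎_θ equals 0. -/
def SlopeZeroRel (θ : ℝ) (V : Set Hei) : Prop :=
  ∃ b : ℝ, Rrot (-θ) '' V = {p : Hei | p.1 = b}

/-- The horizontal line ℝ × {t} in the parabolic plane. -/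
def lineW (t : ℝ) : Set (ℝ × ℝ) := {w | w.2 = t}

/-- Ruler coefficient ρ_f(B_par(w,r)). -/
noncomputable def rulerCoef (f : ℝ × ℝ → Hei) (w : ℝ × ℝ) (r : ℝ) : ℝ :=
  sInf {ρ : ℝ | 0 < ρ ∧ ∀ t : ℝ, ∃ L : Set Hei, IsHorizontalLine L ∧
    f '' (lineW t ∩ BPar w r) ⊆ NH L (ρ * r)}

/-- β_f(𝕍; B_par(w,r)): approximation number relative to the vertical plane 𝕍. -/
noncomputable def betaV (f : ℝ × ℝ → Hei) (V : Set Hei) (w : ℝ × ℝ) (r : ℝ) : ℝ :=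
  sInf {ε : ℝ | 0 < ε ∧ ∀ t : ℝ, ∃ L : Set Hei, IsHorizontalLine L ∧ L ⊆ V ∧
    f '' (lineW t ∩ BPar w r) ⊆ NH L (ε * r)}

/-- The strong vertical β-number β_f(B_par(w,r)) = inf_𝕍 β_f(𝕍; B_par(w,r)). -/
noncomputable def beta (f : ℝ × ℝ → Hei) (w : ℝ × ℝ) (r : ℝ) : ℝ :=
  sInf {b : ℝ | ∃ V : Set Hei, IsVerticalPlane V ∧ b = betaV f V w r}

/-- Index set for dyadic parabolic rectangles: (n, k, l). -/
abbrev Idx : Type := ℤ × ℤ × ℤ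

/-- Side length ℓ(Q) = 2⁻ⁿ of the dyadic parabolic rectangle with index (n,k,l). -/
noncomputable def sideLen (i : Idx) : ℝ := (2 : ℝ) ^ (-i.1)

/-- The dyadic parabolic rectangle [k·2⁻ⁿ, (k+1)·2⁻ⁿ) × [l·4⁻ⁿ, (l+1)·4⁻ⁿ). -/
noncomputable def rect (i : Idx) : Set (ℝ × ℝ) :=
  Set.Ico ((i.2.1 : ℝ) * (2 : ℝ) ^ (-i.1)) (((i.2.1 : ℝ) + 1) * (2 : ℝ) ^ (-i.1)) ×ˢ
  Set.Ico ((i.2.2 : ℝ) * (4 : ℝ) ^ (-i.1)) (((i.2.2 : ℝ) + 1) * (4 : ℝ) ^ (-i.1))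

/-- The centre c_Q of a dyadic parabolic rectangle. -/
noncomputable def center (i : Idx) : ℝ × ℝ :=
  (((i.2.1 : ℝ) + 1 / 2) * (2 : ℝ) ^ (-i.1), ((i.2.2 : ℝ) + 1 / 2) * (4 : ℝ) ^ (-i.1))

/-- λQ := B_par(c_Q, λ·ℓ(Q)). -/
noncomputable def dilate (lam : ℝ) (i : Idx) : Set (ℝ × ℝ) := BPar (center i) (lam * sideLen i)

/-- j indexes a 𝒟-child of the rectangle indexed by i. -/
def IsChild (j i : Idx) : Prop := j.1 = i.1 + 1 ∧ rect j ⊆ rect i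

/-- T ⊆ 𝒟 is a tree with root rt. -/
def IsTreeWithRoot (T : Set Idx) (rt : Idx) : Prop :=
  rt ∈ T ∧ (∀ i ∈ T, rect i ⊆ rect rt) ∧
  (∀ i j k : Idx, i ∈ T → k ∈ T → rect i ⊆ rect j → rect j ⊆ rect k → j ∈ T) ∧
  (∀ i ∈ T, (∀ j : Idx, IsChild j i → j ∈ T) ∨ (∀ j : Idx, IsChild j i → j ∉ T))

/-- T ⊆ 𝒟 is a tree. -/
def IsTree (T : Set Idx) : Prop := ∃ rt : Idx, IsTreeWithRoot T rt

/-- Q is (ε,H,Σ)-vertical for f : there is a vertical plane 𝕍_Q of slope ≤ Σ with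
β_f(𝕍_Q; HQ) < ε/H. -/
def IsVerticalRect (f : ℝ × ℝ → Hei) (ε Hc S : ℝ) (i : Idx) : Prop :=
  ∃ V : Set Hei, VPlaneSlopeLe S V ∧ betaV f V (center i) (Hc * sideLen i) < ε / Hc

/-- Q is (δ,C)-ruled for f. -/
def IsRuled (f : ℝ × ℝ → Hei) (δ C : ℝ) (i : Idx) : Prop :=
  ∀ t : ℝ, ∃ L : Set Hei, IsHorizontalLine L ∧
    f '' (lineW t ∩ dilate C i) ⊆ NH L (δ * sideLen i)

/-- Q is (δ,C,Σ)-ruled for f. -/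
def IsRuledSlope (f : ℝ × ℝ → Hei) (δ C S : ℝ) (i : Idx) : Prop :=
  IsRuled f δ C i ∧ ∃ t : ℝ, (lineW t ∩ rect i).Nonempty ∧
    ∃ L : Set Hei, HLineSlopeLe S L ∧
      f '' (lineW t ∩ dilate C i) ⊆ NH L (δ * sideLen i)

/-- Γ is an intrinsic L-Lipschitz graph over 𝕎. -/
def IsIntrinsicLipGraph (L : ℝ) (Γ : Set Hei) : Prop :=
  Set.BijOn Piproj Γ Wsub ∧
  ∀ p ∈ Γ, ∀ q ∈ Γ,
    Hnorm (PiL (Hmul (Hinv q) p)) ≤ L * Hnorm (Piproj (Hmul (Hinv q) p))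

/-- Γ is an intrinsic L-Lipschitz graph over 𝕎_θ. -/
def IsIntrinsicLipGraphOver (θ L : ℝ) (Γ : Set Hei) : Prop :=
  IsIntrinsicLipGraph L (Rrot (-θ) '' Γ)

/-- An intrinsic bilipschitz graph: an intrinsic Lipschitz graph over some vertical
subgroup which is also a Rickman rug. -/
def IsIntrinsicBilipGraph (Γ : Set Hei) : Prop :=
  (∃ θ ∈ Set.Ico (-(Real.pi / 2)) (Real.pi / 2), ∃ L : ℝ, 1 ≤ L ∧
    IsIntrinsicLipGraphOver θ L Γ) ∧ IsRickmanRug Γ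

/-- (M,ε)-quasi-isometric embedding between sets with distance functions. -/
def IsQIEOn {X Y : Type*} (dX : X → X → ℝ) (dY : Y → Y → ℝ) (A : Set X)
    (M ε : ℝ) (F : X → Y) : Prop :=
  ∀ x ∈ A, ∀ x' ∈ A,
    M⁻¹ * dX x x' - ε ≤ dY (F x) (F x') ∧ dY (F x) (F x') ≤ M * dX x x' + ε

/-- d is a metric on ℝ. -/
def IsMetricOn (d : ℝ → ℝ → ℝ) : Prop :=
  (∀ x y, d x y = d y x) ∧ (∀ x y, d x y = 0 ↔ x = y) ∧
  (∀ x y z, d x z ≤ d x y + d y z)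

/-- d is an orderly metric on ℝ. -/
def Orderly (d : ℝ → ℝ → ℝ) : Prop :=
  IsMetricOn d ∧
  (∀ x : ℝ, ∀ ε > (0 : ℝ), ∃ δ > (0 : ℝ), ∀ y : ℝ, |x - y| < δ → d x y < ε) ∧
  (∀ x y z : ℝ, x ≤ y → y ≤ z → max (d x y) (d y z) ≤ d x z)

/-- F : I×J → 𝕎 is a horizontal (M,ε)-QIE. -/
def IsHorizQIE (M ε : ℝ) (I J : Set ℝ) (F : ℝ × ℝ → ℝ × ℝ) : Prop :=
  IsQIEOn dPar dPar (I ×ˢ J) M ε F ∧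
  (∀ t ∈ J, ∃ c : ℝ, ∀ y ∈ I, (F (y, t)).2 = c)


/-! ### Poincaré–Miranda in the plane -/

lemma stay_between {γ : ℝ → ℝ} (hγ : Continuous γ) {p q α β : ℝ}
    (hp : α < γ p ∧ γ p < β) (h : ∀ x ∈ Set.uIcc p q, γ x ≠ α ∧ γ x ≠ β) :
    α < γ q ∧ γ q < β := by
  have hiv := intermediate_value_uIcc (hγ.continuousOn (s := Set.uIcc p q))
  constructor
  · by_contra hc
    push Not at hc
    obtain ⟨x, hx, hxe⟩ := hiv (Set.mem_uIcc.2 (Or.inr ⟨hc, hp.1.le⟩))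
    exact (h x hx).1 hxe
  · by_contra hc
    push Not at hc
    obtain ⟨x, hx, hxe⟩ := hiv (Set.mem_uIcc.2 (Or.inl ⟨hp.2.le, hc⟩))
    exact (h x hx).2 hxe

/-- No continuous angle function with the boundary signs of the identity map. -/
lemma no_angle (A : ℝ × ℝ → ℝ) (hA : Continuous A) {a b c d : ℝ} (hab : a ≤ b) (hcd : c ≤ d)
    (h0 : -Real.pi < A (b, c) ∧ A (b, c) < Real.pi)
    (hl : ∀ t ∈ Set.Icc c d, Real.cos (A (a, t)) < 0)
    (hr : ∀ t ∈ Set.Icc c d, 0 < Real.cos (A (b, t)))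
    (hb : ∀ y ∈ Set.Icc a b, Real.sin (A (y, c)) < 0)
    (ht : ∀ y ∈ Set.Icc a b, 0 < Real.sin (A (y, d))) : False := by
  have hpi := Real.pi_pos
  have ca : a ∈ Set.Icc a b := ⟨le_rfl, hab⟩
  have cb : b ∈ Set.Icc a b := ⟨hab, le_rfl⟩
  have cc : c ∈ Set.Icc c d := ⟨le_rfl, hcd⟩
  have cd : d ∈ Set.Icc c d := ⟨hcd, le_rfl⟩
  have cos1 : Real.cos (-(Real.pi/2)) = 0 := by rw [Real.cos_neg, Real.cos_pi_div_two]
  have cos3 : Real.cos (3 * Real.pi/2) = 0 := by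
    rw [show 3 * Real.pi/2 = Real.pi/2 + Real.pi by ring, Real.cos_add_pi, Real.cos_pi_div_two,
      neg_zero]
  -- right bottom corner
  have e1 : A (b, c) < 0 := by
    by_contra hc
    push Not at hc
    exact absurd (hb b cb) (not_lt.2 (Real.sin_nonneg_of_nonneg_of_le_pi hc h0.2.le))
  have e2 : -(Real.pi/2) < A (b, c) := by
    by_contra hc
    push Not at hc
    have := hr c cc
    rw [← Real.cos_neg] at this
    exact absurd this (not_lt.2 (Real.cos_nonpos_of_pi_div_two_le_of_le (by linarith) (by linarith)))
  -- right side
  have r := stay_between (γ := fun t => A (b, t)) (by fun_prop) (p := c) (q := d)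
    (α := -(Real.pi/2)) (β := Real.pi/2) ⟨e2, by linarith⟩ (by
      intro x hx
      rw [Set.uIcc_of_le hcd] at hx
      have := hr x hx
      constructor <;> intro hh <;> rw [hh] at this
      · rw [cos1] at this; exact lt_irrefl _ this
      · rw [Real.cos_pi_div_two] at this; exact lt_irrefl _ this)
  have e3 : 0 < A (b, d) := by
    by_contra hc
    push Not at hc
    exact absurd (ht b cb) (not_lt.2 (Real.sin_nonpos_of_nonpos_of_neg_pi_le hc (by linarith)))
  have t := stay_between (γ := fun y => A (y, d)) (by fun_prop) (p := b) (q := a)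
    (α := 0) (β := Real.pi) ⟨e3, by linarith⟩ (by
      intro x hx
      rw [Set.uIcc_of_ge hab] at hx
      have := ht x hx
      constructor <;> intro hh <;> rw [hh] at this
      · simp at this
      · simp at this)
  have e4 : Real.pi/2 < A (a, d) := by
    by_contra hc
    push Not at hc
    exact absurd (hl d cd) (not_lt.2 (Real.cos_nonneg_of_neg_pi_div_two_le_of_le (by linarith) hc))
  have l := stay_between (γ := fun t => A (a, t)) (by fun_prop) (p := d) (q := c)
    (α := Real.pi/2) (β := 3 * Real.pi/2) ⟨e4, by linarith⟩ (by
      intro x hx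
      rw [Set.uIcc_of_ge hcd] at hx
      have := hl x hx
      constructor <;> intro hh <;> rw [hh] at this
      · rw [Real.cos_pi_div_two] at this; exact lt_irrefl _ this
      · rw [cos3] at this; exact lt_irrefl _ this)
  have e5 : Real.pi < A (a, c) := by
    by_contra hc
    push Not at hc
    exact absurd (hb a ca) (not_lt.2 (Real.sin_nonneg_of_nonneg_of_le_pi (by linarith) hc))
  have bb := stay_between (γ := fun y => A (y, c)) (by fun_prop) (p := a) (q := b)
    (α := Real.pi) (β := 2 * Real.pi) ⟨e5, by linarith⟩ (by
      intro x hx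
      rw [Set.uIcc_of_le hab] at hx
      have := hb x hx
      constructor <;> intro hh <;> rw [hh] at this
      · simp at this
      · simp at this)
  linarith [bb.1]

lemma poincare_miranda (F : ℝ × ℝ → ℝ × ℝ) (hF : Continuous F) {a b c d : ℝ}
    (hab : a ≤ b) (hcd : c ≤ d)
    (hl : ∀ t ∈ Set.Icc c d, (F (a, t)).1 < 0)
    (hr : ∀ t ∈ Set.Icc c d, 0 < (F (b, t)).1)
    (hb : ∀ y ∈ Set.Icc a b, (F (y, c)).2 < 0)
    (ht : ∀ y ∈ Set.Icc a b, 0 < (F (y, d)).2) :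
    ∃ w : ℝ × ℝ, w.1 ∈ Set.Icc a b ∧ w.2 ∈ Set.Icc c d ∧ F w = 0 := by
  by_contra hne
  push Not at hne
  let κ : ℝ × ℝ → ℝ × ℝ := fun w => (max a (min b w.1), max c (min d w.2))
  have hκ : Continuous κ := by fun_prop
  have hκid : ∀ w : ℝ × ℝ, w.1 ∈ Set.Icc a b → w.2 ∈ Set.Icc c d → κ w = w := by
    intro w h1 h2
    ext
    · simp [κ, h1.1, h1.2]
    · simp [κ, h2.1, h2.2]
  let G : ℝ × ℝ → ℂ := fun w => ⟨(F (κ w)).1, (F (κ w)).2⟩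
  have hGeq : G = fun w => (((F (κ w)).1 : ℝ) : ℂ) + (((F (κ w)).2 : ℝ) : ℂ) * Complex.I := by
    funext w
    exact Complex.mk_eq_add_mul_I _ _
  have hG : Continuous G := by
    rw [hGeq]
    have := hF.comp hκ
    have h1 : Continuous fun w => (F (κ w)).1 := this.fst
    have h2 : Continuous fun w => (F (κ w)).2 := this.snd
    exact (Complex.continuous_ofReal.comp h1).add
      ((Complex.continuous_ofReal.comp h2).mul continuous_const)
  have hG0 : ∀ w, G w ≠ 0 := by
    intro w h
    refine hne (κ w) ⟨le_max_left _ _, max_le hab (min_le_left _ _)⟩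
      ⟨le_max_left _ _, max_le hcd (min_le_left _ _)⟩ ?_
    have h1 := congrArg Complex.re h
    have h2 := congrArg Complex.im h
    exact Prod.ext h1 h2
  obtain ⟨Z, ⟨hZ0, hZ⟩, -⟩ := Complex.isCoveringMapOn_exp.existsUnique_continuousMap_lifts
    (⟨G, hG⟩ : C(ℝ × ℝ, ℂ)) (a₀ := (b, c)) (e₀ := Complex.log (G (b, c)))
    (Complex.exp_log (hG0 _)) (by intro w; exact hG0 w)
  have hZ' : ∀ w, Complex.exp (Z w) = G w := fun w => congrFun hZ w
  have hre : ∀ w : ℝ × ℝ, w.1 ∈ Set.Icc a b → w.2 ∈ Set.Icc c d →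
      (F w).1 = Real.exp (Z w).re * Real.cos (Z w).im := by
    intro w h1 h2
    rw [← Complex.exp_re, hZ' w]
    simp only [G, hκid w h1 h2]
  have him : ∀ w : ℝ × ℝ, w.1 ∈ Set.Icc a b → w.2 ∈ Set.Icc c d →
      (F w).2 = Real.exp (Z w).re * Real.sin (Z w).im := by
    intro w h1 h2
    rw [← Complex.exp_im, hZ' w]
    simp only [G, hκid w h1 h2]
  have ca : a ∈ Set.Icc a b := ⟨le_rfl, hab⟩
  have cb : b ∈ Set.Icc a b := ⟨hab, le_rfl⟩
  have cc : c ∈ Set.Icc c d := ⟨le_rfl, hcd⟩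
  have cd : d ∈ Set.Icc c d := ⟨hcd, le_rfl⟩
  have hneg : ∀ x y : ℝ, Real.exp x * y < 0 → y < 0 := fun x y h => by
    by_contra hc
    push Not at hc
    exact absurd h (not_lt.2 (mul_nonneg (Real.exp_pos x).le hc))
  have hpos : ∀ x y : ℝ, 0 < Real.exp x * y → 0 < y := fun x y h =>
    (pos_iff_pos_of_mul_pos h).1 (Real.exp_pos x)
  refine no_angle (fun w => (Z w).im) (Complex.continuous_im.comp Z.continuous) hab hcd ?_
    (fun t h => hneg (Z (a, t)).re _ ?_) (fun t h => hpos (Z (b, t)).re _ ?_)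
    (fun y h => hneg (Z (y, c)).re _ ?_) (fun y h => hpos (Z (y, d)).re _ ?_)
  · have him0 : (Z (b, c)).im = (G (b, c)).arg := by rw [hZ0, Complex.log_im]
    simp only [him0]
    refine ⟨Complex.neg_pi_lt_arg _, lt_of_le_of_ne (Complex.arg_le_pi _) fun h => ?_⟩
    rw [Complex.arg_eq_pi_iff] at h
    have h1 : (G (b, c)).re = (F (b, c)).1 := by simp only [G, hκid (b, c) cb cc]
    have := hr c cc
    linarith [h.1]
  · rw [← hre (a, t) ca h]; exact hl t h
  · rw [← hre (b, t) cb h]; exact hr t h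
  · rw [← him (y, c) h cc]; exact hb y h
  · rw [← him (y, d) h cd]; exact ht y h

/-! ### Planar core of the argument -/

lemma exists_sign {x A : ℝ} (h : A ≤ |x|) : ∃ σ : ℝ, (σ = 1 ∨ σ = -1) ∧ A ≤ σ * x := by
  rcases le_total 0 x with h0 | h0
  · exact ⟨1, Or.inl rfl, by rw [abs_of_nonneg h0] at h; linarith⟩
  · exact ⟨-1, Or.inr rfl, by rw [abs_of_nonpos h0] at h; linarith⟩

set_option maxHeartbeats 2000000 in
lemma planar_core {M l Y T : ℝ} (hM : 1 ≤ M) (hl : 0 < l) (hY : Y = 16 * M ^ 3 * l)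
    (hT : T = 16 * M ^ 2 * l ^ 2) (c : ℝ × ℝ) (F : ℝ × ℝ → ℝ × ℝ) (hF : Continuous F)
    (hlow : ∀ w ∈ BPar c Y, ∀ w' ∈ BPar c Y, M⁻¹ * dPar w w' - l / 8 ≤ dPar (F w) (F w'))
    (hup : ∀ w ∈ BPar c Y, ∀ w' ∈ BPar c Y, dPar (F w) (F w') ≤ M * dPar w w' + l / 8)
    (hpl : ∀ w ∈ BPar c Y, ∀ w' ∈ BPar c Y, w.2 = w'.2 →
      |(F w).2 - (F w').2| ≤ 3 * (l / 16) ^ 2) :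
    ∃ m₁ m₂ : ℝ, ∀ u ∈ Set.Icc m₁ (m₁ + l), ∀ s ∈ Set.Icc m₂ (m₂ + l ^ 2),
      ∃ w ∈ BPar c Y, F w = (u, s) := by
  obtain ⟨c₁, c₂⟩ := c
  have hM0 : 0 < M := by linarith
  have hM2 : 1 ≤ M ^ 2 := one_le_pow₀ hM
  have hM3 : 1 ≤ M ^ 3 := one_le_pow₀ hM
  have hY0 : 0 < Y := by rw [hY]; positivity
  have hT0 : 0 < T := by rw [hT]; positivity
  have hM2l : l ≤ M ^ 2 * l := le_mul_of_one_le_left hl.le hM2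
  have hTs : Real.sqrt T = 4 * M * l := by
    rw [hT, show 16 * M ^ 2 * l ^ 2 = (4 * M * l) ^ 2 by ring, Real.sqrt_sq (by positivity)]
  have hTY : Real.sqrt T ≤ Y := by
    rw [hTs, hY]
    have : M ≤ M ^ 3 := le_self_pow₀ hM (by norm_num)
    nlinarith
  have hball : ∀ y t : ℝ, |y - c₁| ≤ Y → |t - c₂| ≤ T → (y, t) ∈ BPar (c₁, c₂) Y := by
    intro y t h1 h2
    exact max_le h1 ((Real.sqrt_le_sqrt h2).trans hTY)
  -- horizontal separation at the centre line
  have hr : ∀ t, |t - c₂| ≤ T → (c₁ + Y, t) ∈ BPar (c₁, c₂) Y := fun t h =>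
    hball _ _ (by simp [abs_of_pos hY0]) h
  have hlft : ∀ t, |t - c₂| ≤ T → (c₁ - Y, t) ∈ BPar (c₁, c₂) Y := fun t h =>
    hball _ _ (by simp [abs_of_pos hY0]) h
  have hc2 : |c₂ - c₂| ≤ T := by simp [hT0.le]
  have hsep : 32 * M ^ 2 * l - l / 8 ≤ |(F (c₁ + Y, c₂)).1 - (F (c₁ - Y, c₂)).1| := by
    have h1 := hlow _ (hr c₂ hc2) _ (hlft c₂ hc2)
    have h2 := hpl _ (hr c₂ hc2) _ (hlft c₂ hc2) rfl
    have h3 : 2 * Y ≤ dPar (c₁ + Y, c₂) (c₁ - Y, c₂) :=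
      le_trans (by simp only; rw [abs_of_nonneg] <;> linarith) (le_max_left _ _)
    have h4 : 32 * M ^ 2 * l ≤ M⁻¹ * dPar (c₁ + Y, c₂) (c₁ - Y, c₂) := by
      rw [le_inv_mul_iff₀ hM0]
      refine le_trans (le_of_eq ?_) h3
      rw [hY]; ring
    have h5 : Real.sqrt |(F (c₁ + Y, c₂)).2 - (F (c₁ - Y, c₂)).2| ≤ l / 8 := by
      apply Real.sqrt_le_iff.2
      constructor
      · positivity
      · nlinarith
    have h6 : 32 * M ^ 2 * l - l / 8 ≤ dPar (F (c₁ + Y, c₂)) (F (c₁ - Y, c₂)) := by linarith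
    rcases le_max_iff.1 h6 with h | h
    · exact h
    · exfalso
      have := h.trans h5
      linarith
  obtain ⟨σ, hσ, hσs⟩ := exists_sign hsep
  have hmove : ∀ y t, |y - c₁| ≤ Y → |t - c₂| ≤ T →
      |(F (y, t)).1 - (F (y, c₂)).1| ≤ 4 * M ^ 2 * l + l / 8 := by
    intro y t h1 h2
    refine (le_max_left _ _).trans ((hup _ (hball y t h1 h2) _ (hball y c₂ h1 hc2)).trans ?_)
    have : dPar (y, t) (y, c₂) ≤ 4 * M * l := by
      refine max_le ?_ ?_
      · simp; positivity
      · rw [← hTs]; exact Real.sqrt_le_sqrt h2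
    nlinarith
  have habsY : |c₁ + Y - c₁| ≤ Y := by simp [abs_of_pos hY0]
  have habsY' : |c₁ - Y - c₁| ≤ Y := by simp [abs_of_pos hY0]
  set m₁ := ((F (c₁ + Y, c₂)).1 + (F (c₁ - Y, c₂)).1) / 2 with hm₁
  have hright : ∀ t, |t - c₂| ≤ T → ∀ u, |u - m₁| ≤ l → 0 < σ * ((F (c₁ + Y, t)).1 - u) := by
    intro t ht u hu
    have h1 := abs_le.1 (hmove _ t habsY ht)
    have h2 := abs_le.1 hu
    rcases hσ with h | h <;> subst h <;> linarith
  have hleft : ∀ t, |t - c₂| ≤ T → ∀ u, |u - m₁| ≤ l → σ * ((F (c₁ - Y, t)).1 - u) < 0 := by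
    intro t ht u hu
    have h1 := abs_le.1 (hmove _ t habsY' ht)
    have h2 := abs_le.1 hu
    rcases hσ with h | h <;> subst h <;> linarith
  have hσ0 : σ ≠ 0 := by rcases hσ with h | h <;> subst h <;> norm_num
  -- points on top and bottom over m₁
  have hivt : ∀ t, |t - c₂| ≤ T → ∃ y, |y - c₁| ≤ Y ∧ (F (y, t)).1 = m₁ := by
    intro t ht
    have hm : |m₁ - m₁| ≤ l := by simp [hl.le]
    have hcont : Continuous fun y => σ * ((F (y, t)).1 - m₁) := by fun_prop
    obtain ⟨y, hy, hy0⟩ := intermediate_value_Icc (a := c₁ - Y) (b := c₁ + Y) (by linarith)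
      hcont.continuousOn ⟨(hleft t ht m₁ hm).le, (hright t ht m₁ hm).le⟩
    refine ⟨y, abs_le.2 ⟨by linarith [hy.1], by linarith [hy.2]⟩, ?_⟩
    rcases mul_eq_zero.1 hy0 with h | h
    · exact absurd h hσ0
    · linarith
  have htop : |c₂ + T - c₂| ≤ T := by simp [abs_of_pos hT0]
  have hbot : |c₂ - T - c₂| ≤ T := by simp [abs_of_pos hT0]
  obtain ⟨y, hy, hFy⟩ := hivt _ htop
  obtain ⟨y', hy', hFy'⟩ := hivt _ hbot
  have hvsep : 9 * l ^ 2 ≤ |(F (y, c₂ + T)).2 - (F (y', c₂ - T)).2| := by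
    have h1 := hlow _ (hball y _ hy htop) _ (hball y' _ hy' hbot)
    have h3 : 4 * M * l ≤ dPar (y, c₂ + T) (y', c₂ - T) := by
      refine le_trans ?_ (le_max_right _ _)
      rw [← hTs]
      apply Real.sqrt_le_sqrt
      simp only
      rw [abs_of_nonneg] <;> linarith
    have h4 : 4 * l ≤ M⁻¹ * dPar (y, c₂ + T) (y', c₂ - T) := by
      rw [le_inv_mul_iff₀ hM0]
      linarith
    have h6 : 3 * l ≤ dPar (F (y, c₂ + T)) (F (y', c₂ - T)) := by linarith
    rcases le_max_iff.1 h6 with h | h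
    · rw [hFy, hFy'] at h
      simp at h
      linarith
    · rw [Real.le_sqrt (by positivity) (abs_nonneg _)] at h
      linarith
  obtain ⟨τ, hτ, hτs⟩ := exists_sign hvsep
  set m₂ := ((F (y, c₂ + T)).2 + (F (y', c₂ - T)).2) / 2 with hm₂
  have hl2 : 0 < l ^ 2 := by positivity
  refine ⟨m₁, m₂, fun u hu s hs => ?_⟩
  have hu' : |u - m₁| ≤ l := abs_le.2 ⟨by linarith [hu.1], by linarith [hu.2]⟩
  have hτ0 : τ ≠ 0 := by rcases hτ with h | h <;> subst h <;> norm_num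
  have habs : ∀ x C R : ℝ, x ∈ Set.Icc (C - R) (C + R) → |x - C| ≤ R := fun x C R h =>
    abs_le.2 ⟨by linarith [h.1], by linarith [h.2]⟩
  obtain ⟨w, hw1, hw2, hw⟩ := poincare_miranda
    (fun w => (σ * ((F w).1 - u), τ * ((F w).2 - s))) (by fun_prop)
    (a := c₁ - Y) (b := c₁ + Y) (c := c₂ - T) (d := c₂ + T) (by linarith) (by linarith)
    (fun t ht => hleft t (habs _ _ _ ht) u hu') (fun t ht => hright t (habs _ _ _ ht) u hu')
    (fun z hz => by
      have h1 := abs_le.1 (hpl _ (hball z _ (habs _ _ _ hz) hbot) _ (hball y' _ hy' hbot) rfl)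
      have h2 := hs.1
      have h3 := hs.2
      simp only
      rcases hτ with h | h <;> subst h <;> nlinarith)
    (fun z hz => by
      have h1 := abs_le.1 (hpl _ (hball z _ (habs _ _ _ hz) htop) _ (hball y _ hy htop) rfl)
      have h2 := hs.1
      have h3 := hs.2
      simp only
      rcases hτ with h | h <;> subst h <;> nlinarith)
  refine ⟨w, hball w.1 w.2 (habs _ _ _ hw1) (habs _ _ _ hw2), ?_⟩
  have h1 := congrArg Prod.fst hw
  have h2 := congrArg Prod.snd hw
  simp only [Prod.fst_zero, Prod.snd_zero, mul_eq_zero, hσ0, hτ0, false_or] at h1 h2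
  exact Prod.ext (by linarith) (by linarith)

/-! ### Basic facts on the Heisenberg metric -/

lemma Hnorm_nonneg (p : Hei) : 0 ≤ Hnorm p := (Real.sqrt_nonneg _).trans (le_max_left _ _)

lemma Hnorm_le_iff {p : Hei} {a : ℝ} (ha : 0 ≤ a) :
    Hnorm p ≤ a ↔ p.1 ^ 2 + p.2.1 ^ 2 ≤ a ^ 2 ∧ |p.2.2| ≤ a ^ 2 := by
  unfold Hnorm
  rw [max_le_iff, Real.sqrt_le_left ha, Real.sqrt_le_left ha]

lemma Hnorm_mul_le (p q : Hei) : Hnorm (Hmul p q) ≤ Hnorm p + Hnorm q := by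
  have ha := Hnorm_nonneg p
  have hb := Hnorm_nonneg q
  obtain ⟨hp1, hp2⟩ := (Hnorm_le_iff ha).1 le_rfl
  obtain ⟨hq1, hq2⟩ := (Hnorm_le_iff hb).1 le_rfl
  set a := Hnorm p
  set b := Hnorm q
  have hprod : (p.1 ^ 2 + p.2.1 ^ 2) * (q.1 ^ 2 + q.2.1 ^ 2) ≤ a ^ 2 * b ^ 2 :=
    mul_le_mul hp1 hq1 (by positivity) (by positivity)
  have h1 : |p.1 * q.1 + p.2.1 * q.2.1| ≤ a * b := by
    apply abs_le_of_sq_le_sq _ (by positivity)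
    nlinarith [sq_nonneg (p.1 * q.2.1 - q.1 * p.2.1)]
  have h2 : |p.1 * q.2.1 - q.1 * p.2.1| ≤ a * b := by
    apply abs_le_of_sq_le_sq _ (by positivity)
    nlinarith [sq_nonneg (p.1 * q.1 + p.2.1 * q.2.1)]
  have hab : 0 ≤ a * b := by positivity
  rw [Hnorm_le_iff (by positivity)]
  rw [abs_le] at *
  simp only [Hmul]
  refine ⟨by nlinarith, ?_⟩
  constructor <;> nlinarith

lemma dH_nonneg (p q : Hei) : 0 ≤ dH p q := Hnorm_nonneg _

lemma dH_comm (p q : Hei) : dH p q = dH q p := by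
  have h : Hmul (Hinv q) p = Hinv (Hmul (Hinv p) q) := by
    simp only [Hmul, Hinv, Prod.mk.injEq]
    refine ⟨by ring, by ring, by ring⟩
  unfold dH
  rw [h]
  simp only [Hnorm, Hinv, neg_sq, abs_neg]

lemma dH_triangle (p q r : Hei) : dH p r ≤ dH p q + dH q r := by
  have h : Hmul (Hinv r) p = Hmul (Hmul (Hinv r) q) (Hmul (Hinv q) p) := by
    simp only [Hmul, Hinv, Prod.mk.injEq]
    refine ⟨by ring, by ring, by ring⟩
  unfold dH
  rw [h, add_comm]
  exact Hnorm_mul_le _ _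

lemma dH_left (a p q : Hei) : dH (Hmul a p) (Hmul a q) = dH p q := by
  have h : Hmul (Hinv (Hmul a q)) (Hmul a p) = Hmul (Hinv q) p := by
    simp only [Hmul, Hinv, Prod.mk.injEq]
    refine ⟨by ring, by ring, by ring⟩
  unfold dH
  rw [h]

lemma Rrot_mul (θ : ℝ) (p q : Hei) : Rrot θ (Hmul p q) = Hmul (Rrot θ p) (Rrot θ q) := by
  simp only [Hmul, Rrot, Prod.mk.injEq]
  refine ⟨by ring, by ring, ?_⟩
  linear_combination (-(p.1 * q.2.1 - q.1 * p.2.1) / 2) * Real.sin_sq_add_cos_sq θ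

lemma Rrot_inv (θ : ℝ) (p : Hei) : Rrot θ (Hinv p) = Hinv (Rrot θ p) := by
  simp only [Hinv, Rrot, Prod.mk.injEq]
  refine ⟨by ring, by ring, trivial⟩

lemma Hnorm_Rrot (θ : ℝ) (p : Hei) : Hnorm (Rrot θ p) = Hnorm p := by
  have : (p.1 * Real.cos θ - p.2.1 * Real.sin θ) ^ 2 + (p.1 * Real.sin θ + p.2.1 * Real.cos θ) ^ 2
      = p.1 ^ 2 + p.2.1 ^ 2 := by
    linear_combination (p.1 ^ 2 + p.2.1 ^ 2) * Real.sin_sq_add_cos_sq θ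
  simp only [Hnorm, Rrot, this]

lemma dH_Rrot (θ : ℝ) (p q : Hei) : dH (Rrot θ p) (Rrot θ q) = dH p q := by
  unfold dH
  rw [← Rrot_inv, ← Rrot_mul, Hnorm_Rrot]

lemma dPar_eq (w w' : ℝ × ℝ) : dPar w w' = dH (embedW w) (embedW w') := by
  simp only [dPar, dH, embedW, Hmul, Hinv, Hnorm]
  congr 1
  · rw [← Real.sqrt_sq_eq_abs]; congr 1; ring
  · congr 2; ring

lemma dH_Piproj (p : Hei) : dH p (Piproj p) ≤ |p.1| := by
  unfold dH
  rw [Hnorm_le_iff (abs_nonneg _)]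
  simp only [Hmul, Hinv, Piproj, sq_abs]
  constructor
  · apply le_of_eq; ring
  · rw [show -(p.2.2 + p.1 * p.2.1 / 2) + p.2.2 + (-0 * p.2.1 - p.1 * -p.2.1) / 2 = 0 by ring]
    simp [sq_nonneg]

lemma near_line {p : Hei} {y k e : ℝ} (h : dH p (0, y, k) < e) :
    |p.1| ≤ e ∧ |p.2.2 + p.1 * p.2.1 / 2 - k| ≤ 3 / 2 * e ^ 2 := by
  have he : 0 ≤ e := (dH_nonneg _ _).trans h.le
  unfold dH at h
  obtain ⟨h1, h2⟩ := (Hnorm_le_iff he).1 h.le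
  simp only [Hmul, Hinv] at h1 h2
  have h3 : |p.1| ≤ e := by
    apply abs_le_of_sq_le_sq _ he
    nlinarith [sq_nonneg (-y + p.2.1)]
  have h4 : |p.2.1 - y| ≤ e := by
    apply abs_le_of_sq_le_sq _ he
    nlinarith [sq_nonneg (-0 + p.1)]
  refine ⟨h3, ?_⟩
  have h5 : |p.1 * (p.2.1 - y)| ≤ e * e := by
    rw [abs_mul]; exact mul_le_mul h3 h4 (abs_nonneg _) he
  rw [abs_le] at *
  constructor <;> nlinarith

lemma continuous_of_bilip {M : ℝ} {f : ℝ × ℝ → Hei} (hf : IsBilipschitz M f) : Continuous f := by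
  rw [continuous_iff_continuousAt]
  intro w'
  have hd : Filter.Tendsto (fun w => M * dPar w w') (nhds w') (nhds 0) := by
    have : Continuous fun w => M * dPar w w' := by unfold dPar; fun_prop
    have h := this.tendsto w'
    simpa [dPar] using h
  have hd2 : Filter.Tendsto (fun w => (M * dPar w w') ^ 2) (nhds w') (nhds 0) := by
    simpa using hd.pow 2
  have key : ∀ w, |(f w).1 - (f w').1| ≤ M * dPar w w' ∧ |(f w).2.1 - (f w').2.1| ≤ M * dPar w w' ∧
      |(f w).2.2 - (f w').2.2 + ((f w).1 * (f w').2.1 - (f w').1 * (f w).2.1) / 2|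
        ≤ (M * dPar w w') ^ 2 := by
    intro w
    have h := (hf w w').2
    have h0 : 0 ≤ M * dPar w w' := (dH_nonneg _ _).trans h
    unfold dH at h
    obtain ⟨h1, h2⟩ := (Hnorm_le_iff h0).1 h
    simp only [Hmul, Hinv] at h1 h2
    refine ⟨?_, ?_, ?_⟩
    · apply abs_le_of_sq_le_sq _ h0
      nlinarith [sq_nonneg (-(f w').2.1 + (f w).2.1)]
    · apply abs_le_of_sq_le_sq _ h0
      nlinarith [sq_nonneg (-(f w').1 + (f w).1)]
    · refine le_trans (le_of_eq ?_) h2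
      congr 1; ring
  have t1 : Filter.Tendsto (fun w => (f w).1) (nhds w') (nhds (f w').1) := by
    rw [tendsto_iff_dist_tendsto_zero]
    exact squeeze_zero (fun _ => dist_nonneg) (fun w => (key w).1) hd
  have t2 : Filter.Tendsto (fun w => (f w).2.1) (nhds w') (nhds (f w').2.1) := by
    rw [tendsto_iff_dist_tendsto_zero]
    exact squeeze_zero (fun _ => dist_nonneg) (fun w => (key w).2.1) hd
  have t3 : Filter.Tendsto (fun w => (f w).2.2 - (f w').2.2 +
      ((f w).1 * (f w').2.1 - (f w').1 * (f w).2.1) / 2) (nhds w') (nhds 0) := by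
    rw [tendsto_zero_iff_abs_tendsto_zero]
    exact squeeze_zero (fun _ => abs_nonneg _) (fun w => (key w).2.2) hd2
  have t4 : Filter.Tendsto (fun w => (f w).2.2) (nhds w') (nhds (f w').2.2) := by
    have := (t3.add_const (f w').2.2).sub
      (((t1.mul_const (f w').2.1).sub (t2.const_mul (f w').1)).div_const 2)
    convert this using 2 <;> ring
  exact t1.prodMk_nhds (t2.prodMk_nhds t4)

/-- Horizontal lines in a plane of slope zero, in normalized coordinates. -/
lemma line_normal {θ b : ℝ} {V L : Set Hei} (hV : Rrot (-θ) '' V = {p : Hei | p.1 = b})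
    (hL : IsHorizontalLine L) (hLV : L ⊆ V) :
    ∃ k : ℝ, ∀ q ∈ L, ∃ y : ℝ, Hmul (-b, 0, 0) (Rrot (-θ) q) = (0, y, k) := by
  obtain ⟨p, v, -, rfl⟩ := hL
  have hx : ∀ s : ℝ, (Rrot (-θ) (Hmul p (s * v.1, s * v.2, 0))).1 = b := by
    intro s
    have : Rrot (-θ) (Hmul p (s * v.1, s * v.2, 0)) ∈ Rrot (-θ) '' V := ⟨_, hLV ⟨s, rfl⟩, rfl⟩
    rw [hV] at this
    exact this
  have h0 := hx 0
  have h1 := hx 1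
  simp only [Rrot_mul] at h0 h1
  set p' := Rrot (-θ) p
  refine ⟨p'.2.2 - b * p'.2.1 / 2, ?_⟩
  rintro q ⟨s, rfl⟩
  rw [Rrot_mul]
  change ∃ y, Hmul (-b, 0, 0) (Hmul p' _) = _
  simp only [Hmul, Rrot] at h0 h1 ⊢
  refine ⟨_, Prod.ext ?_ (Prod.ext rfl ?_)⟩
  · simp only; linear_combination (1 - s) * h0 + s * h1
  · simp only
    have hb : p'.1 = b := by linarith
    have hv : v.1 * Real.cos (-θ) - v.2 * Real.sin (-θ) = 0 := by linarith
    linear_combination (s * v.1 * Real.sin (-θ) + s * v.2 * Real.cos (-θ)) / 2 * hb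
      - s * p'.2.1 / 2 * hv

/-! ### Lower bound for `H3` by Lebesgue measure -/

lemma volume_le_ediamH (θ : ℝ) (U : Set Hei) :
    MeasureTheory.volume {w : ℝ × ℝ | Rrot θ (embedW w) ∈ U} ≤ ediamH U ^ 3 := by
  set A := {w : ℝ × ℝ | Rrot θ (embedW w) ∈ U}
  have hd : ∀ w ∈ A, ∀ w' ∈ A, ENNReal.ofReal (dPar w w') ≤ ediamH U := by
    intro w hw w' hw'
    rw [dPar_eq, ← dH_Rrot θ]
    unfold ediamH
    exact le_iSup₂_of_le _ hw (le_iSup₂_of_le (f := fun q (_ : q ∈ U) =>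
      ENNReal.ofReal (dH (Rrot θ (embedW w)) q)) _ hw' le_rfl)
  have h1 : Metric.ediam (Prod.fst '' A) ≤ ediamH U := by
    apply Metric.ediam_le
    rintro _ ⟨w, hw, rfl⟩ _ ⟨w', hw', rfl⟩
    refine le_trans ?_ (hd w hw w' hw')
    rw [edist_dist, Real.dist_eq]
    exact ENNReal.ofReal_le_ofReal (le_max_left _ _)
  have h2 : Metric.ediam (Prod.snd '' A) ≤ ediamH U ^ 2 := by
    apply Metric.ediam_le
    rintro _ ⟨w, hw, rfl⟩ _ ⟨w', hw', rfl⟩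
    refine le_trans ?_ (pow_le_pow_left' (hd w hw w' hw') 2)
    rw [edist_dist, Real.dist_eq, ← ENNReal.ofReal_pow (by
      exact (abs_nonneg _).trans (le_max_left _ _))]
    apply ENNReal.ofReal_le_ofReal
    calc |w.2 - w'.2| = Real.sqrt |w.2 - w'.2| ^ 2 := (Real.sq_sqrt (abs_nonneg _)).symm
      _ ≤ _ := pow_le_pow_left₀ (Real.sqrt_nonneg _) (le_max_right _ _) 2
  calc MeasureTheory.volume A
      ≤ MeasureTheory.volume ((Prod.fst '' A) ×ˢ (Prod.snd '' A)) :=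
        MeasureTheory.measure_mono fun w hw => ⟨⟨w, hw, rfl⟩, ⟨w, hw, rfl⟩⟩
    _ = MeasureTheory.volume (Prod.fst '' A) * MeasureTheory.volume (Prod.snd '' A) :=
        MeasureTheory.Measure.prod_prod _ _
    _ ≤ ediamH U * ediamH U ^ 2 :=
        mul_le_mul' ((Real.volume_le_diam _).trans h1) ((Real.volume_le_diam _).trans h2)
    _ = ediamH U ^ 3 := by ring

lemma volume_le_H3 (θ : ℝ) (E : Set Hei) :
    MeasureTheory.volume {w : ℝ × ℝ | Rrot θ (embedW w) ∈ E} ≤ H3 E := by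
  unfold H3
  refine le_iSup₂_of_le (⊤ : ℝ≥0∞) (by simp) ?_
  refine le_iInf fun U => le_iInf fun hU => le_iInf fun _ => ?_
  calc MeasureTheory.volume {w : ℝ × ℝ | Rrot θ (embedW w) ∈ E}
      ≤ MeasureTheory.volume (⋃ n, {w : ℝ × ℝ | Rrot θ (embedW w) ∈ U n}) := by
        apply MeasureTheory.measure_mono
        intro w hw
        obtain ⟨n, hn⟩ := Set.mem_iUnion.1 (hU hw)
        exact Set.mem_iUnion.2 ⟨n, hn⟩
    _ ≤ ∑' n, MeasureTheory.volume {w : ℝ × ℝ | Rrot θ (embedW w) ∈ U n} :=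
        MeasureTheory.measure_iUnion_le _
    _ ≤ ∑' n, ediamH (U n) ^ 3 := ENNReal.tsum_le_tsum fun n => volume_le_ediamH θ (U n)

lemma volume_shear (b m₁ m₂ l : ℝ) (hl : 0 < l) (A : Set (ℝ × ℝ))
    (hA : ∀ u ∈ Set.Icc m₁ (m₁ + l), ∀ s ∈ Set.Icc m₂ (m₂ + l ^ 2), (u, s + b * u) ∈ A) :
    ENNReal.ofReal (l ^ 3) ≤ MeasureTheory.volume A := by
  have hmp : MeasureTheory.MeasurePreserving (fun w : ℝ × ℝ => (w.1, b * w.1 + w.2))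
      (MeasureTheory.volume.prod MeasureTheory.volume)
      (MeasureTheory.volume.prod MeasureTheory.volume) := by
    refine (MeasureTheory.MeasurePreserving.id MeasureTheory.volume).skew_product
      (g := fun x y : ℝ => b * x + y) ?_ ?_
    · unfold Function.uncurry; fun_prop
    · exact Filter.Eventually.of_forall fun x =>
        (MeasureTheory.measurePreserving_add_left MeasureTheory.volume (b * x)).map_eq
  have hmeas : MeasurableSet ((fun w : ℝ × ℝ => (w.1, w.2 - b * w.1)) ⁻¹'
      (Set.Icc m₁ (m₁ + l) ×ˢ Set.Icc m₂ (m₂ + l ^ 2))) := by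
    apply (measurableSet_Icc.prod measurableSet_Icc).preimage
    fun_prop
  have h1 := hmp.measure_preimage hmeas.nullMeasurableSet
  have h2 : (fun w : ℝ × ℝ => (w.1, b * w.1 + w.2)) ⁻¹' ((fun w : ℝ × ℝ => (w.1, w.2 - b * w.1)) ⁻¹'
      (Set.Icc m₁ (m₁ + l) ×ˢ Set.Icc m₂ (m₂ + l ^ 2))) =
      Set.Icc m₁ (m₁ + l) ×ˢ Set.Icc m₂ (m₂ + l ^ 2) := by
    ext w
    simp
  rw [h2, MeasureTheory.Measure.prod_prod, Real.volume_Icc, Real.volume_Icc,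
    ← ENNReal.ofReal_mul (by linarith)] at h1
  rw [show l ^ 3 = (m₁ + l - m₁) * (m₂ + l ^ 2 - m₂) by ring, h1]
  apply MeasureTheory.measure_mono
  rintro ⟨u, s⟩ ⟨hu, hs⟩
  have := hA u hu _ hs
  simpa using this

/-- The set defining `betaV` is nonempty. -/
lemma betaV_nonempty {M : ℝ} {f : ℝ × ℝ → Hei} (hM : 1 ≤ M) (hf : IsBilipschitz M f) {V : Set Hei}
    (hV : IsVerticalPlane V) (w : ℝ × ℝ) {r : ℝ} (hr : 0 < r) :
    {ε : ℝ | 0 < ε ∧ ∀ t : ℝ, ∃ L : Set Hei, IsHorizontalLine L ∧ L ⊆ V ∧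
      f '' (lineW t ∩ BPar w r) ⊆ NH L (ε * r)}.Nonempty := by
  obtain ⟨L, hL, rfl⟩ := hV
  have hLV : L ⊆ VSpan L := fun q hq => ⟨q, hq, 0, by simp [Hmul]⟩
  obtain ⟨q, hq⟩ : L.Nonempty := by
    obtain ⟨p, v, -, rfl⟩ := hL
    exact ⟨_, 0, rfl⟩
  have hC := dH_nonneg (f w) q
  refine ⟨M + dH (f w) q / r, by positivity, fun t => ⟨L, hL, hLV, ?_⟩⟩
  rintro _ ⟨z, ⟨-, hz⟩, rfl⟩
  have h1 : distH (f z) L ≤ dH (f z) q :=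
    csInf_le ⟨0, by rintro _ ⟨_, _, rfl⟩; exact dH_nonneg _ _⟩ ⟨q, hq, rfl⟩
  have h2 := dH_triangle (f z) (f w) q
  have h3 := (hf z w).2
  have h4 : M * dPar z w ≤ M * r := mul_le_mul_of_nonneg_left hz (by linarith)
  change distH (f z) L ≤ _
  rw [add_mul, div_mul_cancel₀ _ hr.ne']
  linarith

/-- **Proposition 4.2.** If f(HQ) is well approximated by a vertical plane of
slope 0 relative to 𝕎_θ, then the Π_θ-projection of f(HQ) has measure ≥ ℓ(Q)³. -/
theorem projection_of_vertical_rectangle :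
    ∀ M : ℝ, 1 ≤ M → ∃ Hc : ℝ, 1 ≤ Hc ∧ ∃ ε > (0 : ℝ),
      ∀ f : ℝ × ℝ → Hei, IsBilipschitz M f →
        ∀ θ ∈ Set.Ico (-(Real.pi / 2)) (Real.pi / 2), ∀ i : Idx,
          (∃ V : Set Hei, IsVerticalPlane V ∧ SlopeZeroRel θ V ∧
            betaV f V (center i) (Hc * sideLen i) < ε / Hc) →
          ENNReal.ofReal (sideLen i ^ 3) ≤ H3 (PiTheta θ '' (f '' dilate Hc i)) := by
  intro M hM
  have hM3 : 1 ≤ M ^ 3 := one_le_pow₀ hM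
  refine ⟨16 * M ^ 3, by linarith, 1 / 16, by norm_num, ?_⟩
  rintro f hf θ - i ⟨V, hV, ⟨b, hb⟩, hβ⟩
  set l := sideLen i with hldef
  have hl : 0 < l := by rw [hldef]; unfold sideLen; positivity
  have hY0 : 0 < 16 * M ^ 3 * l := by positivity
  unfold betaV at hβ
  obtain ⟨ε, ⟨hε0, hε⟩, hεlt⟩ := exists_lt_of_csInf_lt
    (betaV_nonempty hM hf hV (center i) hY0) hβ
  have hεl : ε * (16 * M ^ 3 * l) < l / 16 := by
    have := mul_lt_mul_of_pos_right hεlt hY0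
    refine lt_of_lt_of_eq this ?_
    field_simp
  let g : ℝ × ℝ → Hei := fun w => Hmul (-b, 0, 0) (Rrot (-θ) (f w))
  have hgd : ∀ w w', dH (g w) (g w') = dH (f w) (f w') := fun w w' => by
    simp only [g, dH_left, dH_Rrot]
  have hg : IsBilipschitz M g := fun w w' => by rw [hgd]; exact hf w w'
  have hgc : Continuous g := continuous_of_bilip hg
  have hlines : ∀ t : ℝ, ∃ k : ℝ, ∀ w ∈ BPar (center i) (16 * M ^ 3 * l), w.2 = t →
      ∃ y, dH (g w) (0, y, k) < l / 16 := by
    intro t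
    obtain ⟨L, hL, hLV, hsub⟩ := hε t
    obtain ⟨k, hk⟩ := line_normal hb hL hLV
    refine ⟨k, fun w hw hwt => ?_⟩
    have h1 : distH (f w) L ≤ ε * (16 * M ^ 3 * l) := hsub ⟨w, ⟨hwt, hw⟩, rfl⟩
    have hLne : L.Nonempty := by
      obtain ⟨p, v, -, rfl⟩ := hL
      exact ⟨_, 0, rfl⟩
    obtain ⟨_, ⟨q, hq, rfl⟩, hlt⟩ := exists_lt_of_csInf_lt (hLne.image (dH (f w)))
      (lt_of_le_of_lt h1 hεl)
    obtain ⟨y, hy⟩ := hk q hq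
    refine ⟨y, ?_⟩
    rw [← hy]
    simp only [g, dH_left, dH_Rrot]
    exact hlt
  let F : ℝ × ℝ → ℝ × ℝ := fun w => ((g w).2.1, (g w).2.2 + (g w).1 * (g w).2.1 / 2)
  have hFc : Continuous F := by fun_prop
  have hFP : ∀ w, embedW (F w) = Piproj (g w) := fun w => rfl
  have hnear : ∀ w ∈ BPar (center i) (16 * M ^ 3 * l), dH (g w) (embedW (F w)) ≤ l / 16 := by
    intro w hw
    obtain ⟨k, hk⟩ := hlines w.2
    obtain ⟨y, hy⟩ := hk w hw rfl
    exact (dH_Piproj (g w)).trans (near_line hy).1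
  obtain ⟨m₁, m₂, hm⟩ := planar_core hM hl rfl rfl (center i) F hFc
    (by
      intro w hw w' hw'
      rw [dPar_eq (F w)]
      have h1 := dH_triangle (g w) (embedW (F w)) (g w')
      have h2 := dH_triangle (embedW (F w)) (embedW (F w')) (g w')
      have h3 := hnear w hw
      have h4 := hnear w' hw'
      rw [dH_comm] at h4
      linarith [(hg w w').1])
    (by
      intro w hw w' hw'
      rw [dPar_eq (F w)]
      have h1 := dH_triangle (embedW (F w)) (g w) (embedW (F w'))
      have h2 := dH_triangle (g w) (g w') (embedW (F w'))
      have h3 := hnear w hw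
      have h4 := hnear w' hw'
      rw [dH_comm] at h3
      linarith [(hg w w').2])
    (by
      intro w hw w' hw' hww
      obtain ⟨k, hk⟩ := hlines w.2
      obtain ⟨y, hy⟩ := hk w hw rfl
      obtain ⟨y', hy'⟩ := hk w' hw' hww.symm
      have h1 := abs_le.1 (near_line hy).2
      have h2 := abs_le.1 (near_line hy').2
      change |(g w).2.2 + (g w).1 * (g w).2.1 / 2
        - ((g w').2.2 + (g w').1 * (g w').2.1 / 2)| ≤ _
      rw [abs_le]
      constructor <;> linarith [h1.1, h1.2, h2.1, h2.2])
  refine le_trans (volume_shear b m₁ m₂ l hl _ ?_) (volume_le_H3 θ _)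
  intro u hu s hs
  obtain ⟨w, hw, hFw⟩ := hm u hu s hs
  refine ⟨f w, ⟨w, hw, rfl⟩, ?_⟩
  unfold PiTheta
  congr 1
  have h1 : (F w).1 = u := by rw [hFw]
  have h2 : (F w).2 = s := by rw [hFw]
  simp only [F, g, Hmul] at h1 h2
  simp only [Piproj, embedW, Prod.mk.injEq, true_and]
  constructor
  · linarith
  · rw [← h1, ← h2]; ring

end HeisRug
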